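/- In a minimal counterexample, every vertex of degree 7 has at most four neighbors of degree 5. -/

import Mathlib

open SimpleGraph

variable {V : Type}

/-- The involution of the darts of a graph reversing each dart. -/
def dartRev (G : SimpleGraph V) : Equiv.Perm G.Dart :=
  Function.Involutive.toPerm SimpleGraph.Dart.symm SimpleGraph.Dart.symm_involutive

/-- The face permutation of a rotation system `σ`: it sends a dart `(u,v)` to `σ (v,u)`. -/
def facePerm {G : SimpleGraph V} (σ : Equiv.Perm G.Dart) : Equiv.Perm G.Dart :=
  (dartRev G).trans σ

/-- The setoid on `α` whose classes are the orbits (cycles) of a permutation of `α`. -/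
def orbitSetoid {α : Type*} (f : Equiv.Perm α) : Setoid α :=
  ⟨f.SameCycle, ⟨fun x => Equiv.Perm.SameCycle.refl f x, fun h => h.symm, fun h h' => h.trans h'⟩⟩

/-- The number of faces of a rotation system: the number of orbits of the face permutation. -/
noncomputable def numFaces {G : SimpleGraph V} (σ : Equiv.Perm G.Dart) : ℕ :=
  Nat.card (Quotient (orbitSetoid (facePerm σ)))

/-- The number of darts in the face (orbit of the face permutation) containing the dart `d`. -/
noncomputable def faceSize {G : SimpleGraph V} (σ : Equiv.Perm G.Dart) (d : G.Dart) : ℕ :=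
  Nat.card {e : G.Dart // (facePerm σ).SameCycle d e}

/-- `σ` is a rotation system on `G`: every dart and its image share their first vertex, and
the `σ`-orbit of every dart consists of all darts sharing its first vertex. -/
structure IsRotationSystem (G : SimpleGraph V) (σ : Equiv.Perm G.Dart) : Prop where
  fst_eq : ∀ d : G.Dart, (σ d).toProd.1 = d.toProd.1
  orbit_eq : ∀ d e : G.Dart, d.toProd.1 = e.toProd.1 → σ.SameCycle d e

/-- The degree of a vertex. -/
noncomputable def deg (G : SimpleGraph V) (v : V) : ℕ := Nat.card (G.neighborSet v)

/-- A plane triangulation: a finite connected simple graph on at least 4 vertices equipped with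
a rotation system satisfying Euler's formula `|V| - |E| + F = 2` in which every face consists of
exactly 3 darts. -/
structure IsPlaneTriangulation [Fintype V] (G : SimpleGraph V) (σ : Equiv.Perm G.Dart) :
    Prop where
  connected : G.Connected
  four_le_card : 4 ≤ Fintype.card V
  rot : IsRotationSystem G σ
  euler : Fintype.card V + numFaces σ = Nat.card G.edgeSet + 2
  face_size_eq : ∀ d : G.Dart, faceSize σ d = 3

/-- A proper 5-coloring (colors `0,...,4` standing for `1,...,5`). -/
def Proper5 (G : SimpleGraph V) (c : V → Fin 5) : Prop :=
  ∀ ⦃u w : V⦄, G.Adj u w → c u ≠ c w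

/-- A finite simple graph is planar if it is isomorphic to a subgraph of a plane triangulation. -/
def IsPlanar [Fintype V] (G : SimpleGraph V) : Prop :=
  ∃ (W : Type) (iW : Fintype W) (T : SimpleGraph W) (σ : Equiv.Perm T.Dart),
    @IsPlaneTriangulation W iW T σ ∧ ∃ f : G →g T, Function.Injective f

/-- `w` is the neighbor of `v` following `u` in the cyclic (counterclockwise) order
around `v` given by the rotation system `σ`. -/
def NextNbr {G : SimpleGraph V} (σ : Equiv.Perm G.Dart) (v u w : V) : Prop :=
  ∃ h : G.Adj v u, (σ ⟨(v, u), h⟩).toProd.2 = w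

/-- A minimal counterexample: a plane triangulation admitting no proper 5-coloring with some
color class of size at most `|V|/6`, while every planar graph on fewer vertices admits one. -/
def IsMinimalCounterexample [Fintype V] (G : SimpleGraph V) (σ : Equiv.Perm G.Dart) : Prop :=
  IsPlaneTriangulation G σ ∧
  (¬ ∃ c : V → Fin 5, Proper5 G c ∧
      ∃ k : Fin 5, 6 * Nat.card {v : V | c v = k} ≤ Fintype.card V) ∧
  (∀ (W : Type) [Fintype W] (H : SimpleGraph W), IsPlanar H →
      Fintype.card W < Fintype.card V →
      ∃ c : W → Fin 5, Proper5 H c ∧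
        ∃ k : Fin 5, 6 * Nat.card {w : W | c w = k} ≤ Fintype.card W)

section Planar

open Classical in
/-- boundary of a face chain -/
noncomputable def bd2 [Fintype V] (G : SimpleGraph V) (σ : Equiv.Perm G.Dart) :
    (Quotient (orbitSetoid (facePerm σ)) → ZMod 2) →ₗ[ZMod 2] (G.edgeSet → ZMod 2) where
  toFun f := fun e => ∑ d : G.Dart with d.edge = e.1, f (Quotient.mk _ d)
  map_add' f g := by
    funext e
    simp [Finset.sum_add_distrib]
  map_smul' r f := by
    funext e
    simp [Finset.mul_sum]

open Classical in
/-- boundary of an edge chain -/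
noncomputable def bd1 [Fintype V] (G : SimpleGraph V) :
    (G.edgeSet → ZMod 2) →ₗ[ZMod 2] (V → ZMod 2) where
  toFun z := fun v => ∑ d : G.Dart with d.fst = v, z ⟨d.edge, d.edge_mem⟩
  map_add' f g := by
    funext e
    simp [Finset.sum_add_distrib]
  map_smul' r f := by
    funext e
    simp [Finset.mul_sum]

theorem fun_add_self (g : V → ZMod 2) : g + g = 0 := by
  funext x
  exact CharTwo.add_self_eq_zero _

theorem mk_symm_eq {G : SimpleGraph V} (σ : Equiv.Perm G.Dart) (d : G.Dart) :
    (Quotient.mk (orbitSetoid (facePerm σ)) d.symm) =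
      Quotient.mk (orbitSetoid (facePerm σ)) (σ d) := by
  apply Quotient.sound
  show (facePerm σ).SameCycle d.symm (σ d)
  refine ⟨1, ?_⟩
  simp [facePerm, dartRev, Function.Involutive.toPerm]

theorem bd2_apply [Fintype V] (G : SimpleGraph V) (σ : Equiv.Perm G.Dart)
    (f : Quotient (orbitSetoid (facePerm σ)) → ZMod 2) (d : G.Dart) :
    bd2 G σ f ⟨d.edge, d.edge_mem⟩ =
      f (Quotient.mk _ d) + f (Quotient.mk _ (σ d)) := by
  classical
  rw [← mk_symm_eq]
  show (∑ d' : G.Dart with d'.edge = d.edge, f (Quotient.mk _ d')) = _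
  have h : (Finset.univ.filter fun d' : G.Dart => d'.edge = d.edge) = {d, d.symm} := by
    ext d'
    simp [SimpleGraph.dart_edge_eq_iff]
  rw [h, Finset.sum_pair (SimpleGraph.Dart.symm_ne d).symm]

theorem bd1_bd2 [Fintype V] (G : SimpleGraph V) (σ : Equiv.Perm G.Dart)
    (hσ : IsRotationSystem G σ) (f : Quotient (orbitSetoid (facePerm σ)) → ZMod 2) :
    bd1 G (bd2 G σ f) = 0 := by
  classical
  funext v
  show (∑ d : G.Dart with d.fst = v, bd2 G σ f ⟨d.edge, d.edge_mem⟩) = 0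
  simp only [bd2_apply, Finset.sum_add_distrib]
  have h : (∑ d : G.Dart with d.fst = v, f (Quotient.mk _ (σ d))) =
      ∑ d : G.Dart with d.fst = v, f (Quotient.mk _ d) := by
    refine Finset.sum_equiv σ ?_ ?_
    · intro d
      have := hσ.fst_eq d
      simp only [Finset.mem_filter, Finset.mem_univ, true_and]
      rw [this]
    · intro d _
      rfl
  rw [h]
  exact CharTwo.add_self_eq_zero _

theorem pow_fst {G : SimpleGraph V} {σ : Equiv.Perm G.Dart}
    (hσ : IsRotationSystem G σ) (d : G.Dart) (n : ℕ) : ((σ ^ n) d).fst = d.fst := by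
  induction n with
  | zero => rfl
  | succ n ih =>
    rw [pow_succ', Equiv.Perm.mul_apply]
    exact (hσ.fst_eq _).trans ih

theorem exists_pow [Fintype V] {G : SimpleGraph V} {σ : Equiv.Perm G.Dart}
    (hσ : IsRotationSystem G σ) (d e : G.Dart) (h : d.fst = e.fst) :
    ∃ n : ℕ, (σ ^ n) d = e := by
  classical
  obtain ⟨n, -, hn⟩ := (hσ.orbit_eq d e h).exists_pow_eq'
  exact ⟨n, hn⟩

/-- A function on darts that is invariant along the rotation is constant on stars. -/
theorem star_const [Fintype V] {G : SimpleGraph V} {σ : Equiv.Perm G.Dart}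
    (hσ : IsRotationSystem G σ) {α : Type*} (g : G.Dart → α) (x : V)
    (hg : ∀ d : G.Dart, d.fst = x → g (σ d) = g d) (d e : G.Dart) (hd : d.fst = x)
    (he : e.fst = x) : g d = g e := by
  obtain ⟨n, rfl⟩ := exists_pow hσ d e (hd.trans he.symm)
  clear he
  induction n with
  | zero => rfl
  | succ n ih =>
    rw [pow_succ', Equiv.Perm.mul_apply, hg _ ((pow_fst hσ d n).trans hd)]
    exact ih

theorem ker_bd2 [Fintype V] {G : SimpleGraph V} {σ : Equiv.Perm G.Dart}
    (hG : IsPlaneTriangulation G σ) (f : Quotient (orbitSetoid (facePerm σ)) → ZMod 2)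
    (hf : bd2 G σ f = 0) (d e : G.Dart) : f (Quotient.mk _ d) = f (Quotient.mk _ e) := by
  have h1 : ∀ d : G.Dart, f (Quotient.mk _ (σ d)) = f (Quotient.mk _ d) := by
    intro d
    have h := bd2_apply G σ f d
    rw [hf] at h
    exact (CharTwo.add_eq_zero.mp h.symm).symm
  have h2 : ∀ d : G.Dart, f (Quotient.mk _ d.symm) = f (Quotient.mk _ d) := by
    intro d
    rw [mk_symm_eq, h1]
  have h3 : ∀ d e : G.Dart, d.fst = e.fst → f (Quotient.mk _ d) = f (Quotient.mk _ e) :=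
    fun d e hde => star_const hG.rot (fun d => f (Quotient.mk _ d)) e.fst (fun d _ => h1 d) d e
      hde rfl
  have h4 : ∀ u w : V, G.Reachable u w → ∀ d e : G.Dart, d.fst = u → e.fst = w →
      f (Quotient.mk _ d) = f (Quotient.mk _ e) := by
    rintro u w ⟨p⟩
    induction p with
    | nil => intro d e hd he; exact h3 d e (hd.trans he.symm)
    | cons h p ih =>
      intro d e hd he
      rw [h3 d ⟨(_, _), h⟩ hd, ← h2]
      exact ih _ _ rfl he
  exact h4 _ _ (hG.connected.preconnected d.fst e.fst) d e rfl rfl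

open Classical in
theorem bd1_single [Fintype V] (G : SimpleGraph V) (d : G.Dart) :
    bd1 G (Pi.single ⟨d.edge, d.edge_mem⟩ 1) = Pi.single d.fst 1 + Pi.single d.snd 1 := by
  funext v
  show (∑ d' : G.Dart with d'.fst = v,
    (Pi.single (⟨d.edge, d.edge_mem⟩ : G.edgeSet) (1 : ZMod 2) : G.edgeSet → ZMod 2)
      ⟨d'.edge, d'.edge_mem⟩) = _
  have : ∀ d' : G.Dart, (Pi.single (⟨d.edge, d.edge_mem⟩ : G.edgeSet) (1 : ZMod 2) : G.edgeSet → ZMod 2)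
      ⟨d'.edge, d'.edge_mem⟩ = (if d' = d then 1 else 0) + (if d' = d.symm then 1 else 0) := by
    intro d'
    rw [Pi.single_apply]
    by_cases h1 : d' = d
    · subst h1
      simp [(SimpleGraph.Dart.symm_ne d').symm]
    · by_cases h2 : d' = d.symm
      · subst h2
        simp [SimpleGraph.Dart.symm_ne d]
      · have : ¬ (d'.edge = d.edge) := by
          rw [SimpleGraph.dart_edge_eq_iff]; tauto
        simp [h1, h2, this]
  simp only [this, Finset.sum_add_distrib, Finset.sum_ite_eq', Pi.add_apply, Pi.single_apply,
    Finset.mem_filter, Finset.mem_univ, true_and]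
  rw [@eq_comm _ v, @eq_comm _ v]
  rfl

theorem exists_face_fun [Fintype V] {G : SimpleGraph V} {σ : Equiv.Perm G.Dart}
    (hG : IsPlaneTriangulation G σ) (z : G.edgeSet → ZMod 2) (hz : bd1 G z = 0) :
    ∃ f : Quotient (orbitSetoid (facePerm σ)) → ZMod 2, bd2 G σ f = z := by
  classical
  have hle : LinearMap.range (bd2 G σ) ≤ LinearMap.ker (bd1 G) := by
    rintro _ ⟨f, rfl⟩
    exact bd1_bd2 G σ hG.rot f
  obtain ⟨v0⟩ := hG.connected.nonempty
  -- range of bd1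
  have h1 : LinearMap.range (bd1 G) ⊔ Submodule.span (ZMod 2) {Pi.single v0 1} = ⊤ := by
    have key : ∀ v : V, (Pi.single v 1 : V → ZMod 2) ∈
        LinearMap.range (bd1 G) ⊔ Submodule.span (ZMod 2) {Pi.single v0 1} := by
      intro v
      obtain ⟨p⟩ := hG.connected.preconnected v v0
      induction p with
      | nil => exact Submodule.mem_sup_right (Submodule.mem_span_singleton_self _)
      | @cons u x w h p ih =>
        have h2 : (Pi.single u 1 : V → ZMod 2) =
            bd1 G (Pi.single ⟨(⟨(u, x), h⟩ : G.Dart).edge, SimpleGraph.Dart.edge_mem _⟩ 1)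
              + Pi.single x 1 := by
          rw [bd1_single]
          show _ = Pi.single u 1 + Pi.single x 1 + Pi.single x 1
          rw [add_assoc, fun_add_self, add_zero]
        rw [h2]
        exact Submodule.add_mem _ (Submodule.mem_sup_left ⟨_, rfl⟩) ih
    rw [eq_top_iff]
    intro g _
    rw [pi_eq_sum_univ' g]
    refine Submodule.sum_mem _ fun v _ => Submodule.smul_mem _ _ ?_
    convert key v using 1
  have h2 : Fintype.card V ≤ Module.finrank (ZMod 2) (LinearMap.range (bd1 G)) + 1 := by
    have := Submodule.finrank_add_le_finrank_add_finrank (LinearMap.range (bd1 G))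
      (Submodule.span (ZMod 2) {(Pi.single v0 1 : V → ZMod 2)})
    rw [h1, finrank_top, Module.finrank_fintype_fun_eq_card] at this
    have h3 := finrank_span_le_card (R := ZMod 2) ({(Pi.single v0 1 : V → ZMod 2)} : Set (V → ZMod 2))
    simp at h3
    omega
  have h3 := LinearMap.finrank_range_add_finrank_ker (bd1 G)
  have h4 := LinearMap.finrank_range_add_finrank_ker (bd2 G σ)
  rw [Module.finrank_fintype_fun_eq_card] at h3 h4
  have h5 : Module.finrank (ZMod 2) (LinearMap.ker (bd2 G σ)) ≤ 1 := by
    have : LinearMap.ker (bd2 G σ) ≤ Submodule.span (ZMod 2) {fun _ => 1} := by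
      intro f hf
      rw [Submodule.mem_span_singleton]
      by_cases hne : Nonempty G.Dart
      · obtain ⟨d⟩ := hne
        refine ⟨f (Quotient.mk _ d), ?_⟩
        funext q
        induction q using Quotient.inductionOn with
        | h e => simp [ker_bd2 hG f hf d e]
      · refine ⟨0, ?_⟩
        funext q
        induction q using Quotient.inductionOn with
        | h e => exact absurd ⟨e⟩ hne
    refine (Submodule.finrank_mono this).trans ?_
    have h3 := finrank_span_le_card (R := ZMod 2)
      ({(fun _ => 1 : Quotient (orbitSetoid (facePerm σ)) → ZMod 2)} : Set _)
    simpa using h3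
  have h6 := hG.euler
  unfold numFaces at h6
  rw [Nat.card_eq_fintype_card, Nat.card_eq_fintype_card] at h6
  have h7 : LinearMap.range (bd2 G σ) = LinearMap.ker (bd1 G) :=
    Submodule.eq_of_le_of_finrank_le hle (by omega)
  have : z ∈ LinearMap.range (bd2 G σ) := by
    rw [h7]; exact hz
  exact this

/-- adjacency inside a vertex set -/
def InAdj (G : SimpleGraph V) (A : V → Prop) (x y : V) : Prop := G.Adj x y ∧ A x ∧ A y

open Classical in
theorem exists_chain [Fintype V] (G : SimpleGraph V) (A : V → Prop) (x y : V)
    (h : Relation.ReflTransGen (InAdj G A) x y) :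
    ∃ z : G.edgeSet → ZMod 2, bd1 G z = Pi.single x 1 + Pi.single y 1 ∧
      ∀ d : G.Dart, ¬ A d.fst → z ⟨d.edge, d.edge_mem⟩ = 0 := by
  induction h with
  | refl => exact ⟨0, by rw [map_zero, fun_add_self], fun _ _ => rfl⟩
  | @tail b c _ hbc ih =>
    obtain ⟨z, hz, hs⟩ := ih
    let e : G.Dart := ⟨(b, c), hbc.1⟩
    refine ⟨z + Pi.single ⟨e.edge, e.edge_mem⟩ 1, ?_, ?_⟩
    · have h1 := bd1_single G e
      rw [map_add, hz]
      have h2 : bd1 G (Pi.single ⟨e.edge, e.edge_mem⟩ 1) =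
        (Pi.single b 1 + Pi.single c 1 : V → ZMod 2) := h1
      rw [h2]
      have h3 : (Pi.single b 1 + Pi.single b 1 : V → ZMod 2) = 0 := fun_add_self _
      calc _ = Pi.single x 1 + (Pi.single b 1 + Pi.single b 1 : V → ZMod 2) + Pi.single c 1 := by abel
        _ = _ := by rw [h3, add_zero]
    · intro d hd
      rw [Pi.add_apply, hs d hd, zero_add, Pi.single_apply, if_neg]
      intro hh
      have hh' : d.edge = e.edge := congrArg Subtype.val hh
      rw [SimpleGraph.dart_edge_eq_iff] at hh'
      rcases hh' with rfl | rfl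
      · exact hd hbc.2.1
      · exact hd hbc.2.2

/-- The crossing lemma. -/
theorem crossing [Fintype V] {G : SimpleGraph V} {σ : Equiv.Perm G.Dart}
    (hG : IsPlaneTriangulation G σ) (A B : V → Prop) (hAB : ∀ x, A x → ¬ B x) (w : V)
    (hAw : ¬ A w) (hBw : ¬ B w) (d : G.Dart) (hd : d.fst = w) (i j k : ℕ)
    (hi : 0 < i) (hij : i < j) (hjk : j < k)
    (hmin : ∀ n < k, (σ ^ n) d ≠ (σ ^ k) d)
    (h0 : A d.snd) (h1 : B ((σ ^ i) d).snd) (h2 : A ((σ ^ j) d).snd) (h3 : B ((σ ^ k) d).snd)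
    (hA : Relation.ReflTransGen (InAdj G A) d.snd ((σ ^ j) d).snd)
    (hB : Relation.ReflTransGen (InAdj G B) ((σ ^ i) d).snd ((σ ^ k) d).snd) : False := by
  classical
  have hinj : ∀ m n, m < n → n ≤ k → (σ ^ m) d ≠ (σ ^ n) d := by
    intro m n hmn hnk h
    refine hmin (k - n + m) (by omega) ?_
    rw [pow_add, Equiv.Perm.mul_apply, h, ← Equiv.Perm.mul_apply, ← pow_add]
    congr 2
    omega
  obtain ⟨z, hz, hs⟩ := exists_chain G A _ _ hA
  set e : G.Dart := (σ ^ j) d with he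
  have hew : e.fst = w := (pow_fst hG.rot d j).trans hd
  set Z : G.edgeSet → ZMod 2 := z + (Pi.single ⟨d.edge, d.edge_mem⟩ 1 + Pi.single ⟨e.edge, e.edge_mem⟩ 1) with hZ
  have hbZ : bd1 G Z = 0 := by
    rw [hZ, map_add, map_add, bd1_single, bd1_single, hz, hd, hew]
    calc _ = (Pi.single d.snd 1 + Pi.single d.snd 1) + (Pi.single e.snd 1 + Pi.single e.snd 1)
          + (Pi.single w 1 + Pi.single w 1 : V → ZMod 2) := by abel
      _ = 0 := by
        rw [fun_add_self (Pi.single d.snd 1), fun_add_self (Pi.single e.snd 1),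
          fun_add_self (Pi.single w 1), add_zero, add_zero]
  obtain ⟨f, hf⟩ := exists_face_fun hG Z hbZ
  have hstep : ∀ a : G.Dart, f (Quotient.mk _ (σ a)) = f (Quotient.mk _ a) +
      Z ⟨a.edge, a.edge_mem⟩ := by
    intro a
    rw [← hf, bd2_apply, ← add_assoc, CharTwo.add_self_eq_zero, zero_add]
  -- values of `Z`
  have hZw : ∀ a : G.Dart, a.fst = w → Z ⟨a.edge, a.edge_mem⟩ =
      (if a = d then 1 else 0) + (if a = e then 1 else 0) := by
    intro a ha
    rw [hZ, Pi.add_apply, Pi.add_apply, hs a (by rw [ha]; exact hAw), zero_add, Pi.single_apply,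
      Pi.single_apply]
    have key : ∀ b : G.Dart, b.fst = w → ((⟨a.edge, a.edge_mem⟩ : G.edgeSet) = ⟨b.edge, b.edge_mem⟩
        ↔ a = b) := by
      intro b hb
      rw [Subtype.mk_eq_mk, SimpleGraph.dart_edge_eq_iff]
      constructor
      · rintro (h | h)
        · exact h
        · exfalso
          have h5 : a.fst = b.snd := by rw [h]; rfl
          exact b.adj.ne (by rw [hb, ← ha]; exact h5)
      · exact Or.inl
    simp only [key d hd, key e hew]
  have hZ0 : ∀ a : G.Dart, a.fst ≠ w → ¬ A a.fst → Z ⟨a.edge, a.edge_mem⟩ = 0 := by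
    intro a ha ha'
    have key : ∀ b : G.Dart, b.fst = w → A b.snd →
        ¬ ((⟨a.edge, a.edge_mem⟩ : G.edgeSet) = ⟨b.edge, b.edge_mem⟩) := by
      intro b hb hb'
      rw [Subtype.mk_eq_mk, SimpleGraph.dart_edge_eq_iff]
      rintro (h | h)
      · rw [h] at ha; exact ha hb
      · rw [h] at ha'; exact ha' hb'
    rw [hZ, Pi.add_apply, Pi.add_apply, hs a ha', zero_add, Pi.single_apply,
      Pi.single_apply, if_neg (key d hd h0), if_neg (key e hew h2), add_zero]
  -- around `w`
  have hv : ∀ n, 1 ≤ n → n ≤ k → f (Quotient.mk _ ((σ ^ n) d)) =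
      f (Quotient.mk _ d) + 1 + (if j < n then 1 else 0) := by
    intro n hn
    induction n, hn using Nat.le_induction with
    | base =>
      intro _
      rw [pow_one, hstep, hZw d hd, if_pos rfl, if_neg, if_neg (by omega), add_zero, add_zero]
      exact hinj 0 j (by omega) hjk.le
    | succ n hn ih =>
      intro hnk
      rw [pow_succ', Equiv.Perm.mul_apply, hstep, ih (by omega),
        hZw _ ((pow_fst hG.rot d n).trans hd), if_neg (show (σ ^ n) d ≠ d from (hinj 0 n (by omega) (by omega)).symm), zero_add]
      rcases lt_trichotomy n j with h | h | h
      · rw [if_neg (by omega), if_neg (hinj n j h hjk.le), if_neg (by omega)]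
        simp
      · subst h
        rw [if_neg (by omega), if_pos rfl, if_pos (by omega)]
        simp
      · rw [if_pos h, if_neg (hinj j n h (by omega)).symm, if_pos (by omega)]
        simp
  have hBne : ∀ x, B x → x ≠ w := fun x hx h => hBw (h ▸ hx)
  have hsymm : ∀ a : G.Dart, B a.fst → f (Quotient.mk _ a.symm) = f (Quotient.mk _ a) := by
    intro a ha
    rw [mk_symm_eq, hstep, hZ0 a (hBne _ ha) (fun h => hAB _ h ha), add_zero]
  have hstar : ∀ a b : G.Dart, B a.fst → a.fst = b.fst →
      f (Quotient.mk _ a) = f (Quotient.mk _ b) := by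
    intro a b ha hab
    refine star_const hG.rot (fun d => f (Quotient.mk _ d)) a.fst ?_ a b rfl hab.symm
    intro c hc
    show f (Quotient.mk _ (σ c)) = f (Quotient.mk _ c)
    rw [hstep, hZ0 c (by rw [hc]; exact hBne _ ha) (by rw [hc]; exact fun h => hAB _ h ha), add_zero]
  have hreach : ∀ x y, Relation.ReflTransGen (InAdj G B) x y → B x → ∀ a b : G.Dart,
      a.fst = x → b.fst = y → f (Quotient.mk _ a) = f (Quotient.mk _ b) := by
    intro x y h hx
    induction h with
    | refl => intro a b ha hb; exact hstar a b (by rw [ha]; exact hx) (ha.trans hb.symm)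
    | @tail y y' _ hyy ih =>
      intro a b ha hb
      let c : G.Dart := ⟨(y, y'), hyy.1⟩
      rw [ih a c ha rfl, ← hsymm c hyy.2.1]
      exact hstar _ _ hyy.2.2 hb.symm
  have hfin := hreach _ _ hB h1 ((σ ^ i) d).symm ((σ ^ k) d).symm rfl rfl
  have e1 : f (Quotient.mk _ ((σ ^ i) d).symm) = f (Quotient.mk _ ((σ ^ i) d)) :=
    (hsymm ((σ ^ i) d).symm h1).symm
  have e2 : f (Quotient.mk _ ((σ ^ k) d).symm) = f (Quotient.mk _ ((σ ^ k) d)) :=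
    (hsymm ((σ ^ k) d).symm h3).symm
  rw [e1, e2, hv i hi (by omega), hv k (by omega) le_rfl, if_neg (by omega), if_pos hjk] at hfin
  have h9 : (0 : ZMod 2) = 1 := add_left_cancel hfin
  exact zero_ne_one h9

end Planar

section Kempe

/-- proper off the uncoloured set `U` -/
def PropOff (G : SimpleGraph V) (U : Finset V) (c : V → Fin 5) : Prop :=
  ∀ x y : V, G.Adj x y → x ∉ U → y ∉ U → c x ≠ c y

/-- the result of colouring `w` without touching the last colour class -/
def Extends (G : SimpleGraph V) [DecidableEq V] (U : Finset V) (c : V → Fin 5) (w : V) : Prop :=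
  ∃ c' : V → Fin 5, PropOff G (U.erase w) c' ∧ (∀ x ∉ U, (c' x = 4 ↔ c x = 4)) ∧ c' w ≠ 4

theorem extend_free [DecidableEq V] {G : SimpleGraph V} {U : Finset V} {c : V → Fin 5} {w : V}
    (hc : PropOff G U c) (hw : w ∈ U) (k : Fin 5)
    (hfree : ∀ x, G.Adj w x → x ∉ U → c x ≠ k) :
    PropOff G (U.erase w) (Function.update c w k) := by
  intro x y hxy hx hy
  have hne := hxy.ne
  by_cases h1 : x = w
  · subst h1
    have hyU : y ∉ U := fun h => hy (Finset.mem_erase.mpr ⟨hne.symm, h⟩)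
    rw [Function.update_self, Function.update_of_ne hne.symm]
    exact (hfree y hxy hyU).symm
  · have hxU : x ∉ U := fun h => hx (Finset.mem_erase.mpr ⟨h1, h⟩)
    by_cases h2 : y = w
    · subst h2
      rw [Function.update_self, Function.update_of_ne hne]
      exact hfree x hxy.symm hxU
    · have hyU : y ∉ U := fun h => hy (Finset.mem_erase.mpr ⟨h2, h⟩)
      rw [Function.update_of_ne h1, Function.update_of_ne h2]
      exact hc x y hxy hxU hyU

theorem extends_free [DecidableEq V] {G : SimpleGraph V} {U : Finset V} {c : V → Fin 5} {w : V}
    (hc : PropOff G U c) (hw : w ∈ U) (k : Fin 5) (hk : k ≠ 4)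
    (hfree : ∀ x, G.Adj w x → x ∉ U → c x ≠ k) : Extends G U c w := by
  refine ⟨_, extend_free hc hw k hfree, ?_, by simpa using hk⟩
  intro x hx
  have hxw : x ≠ w := by rintro rfl; exact hx hw
  rw [Function.update_of_ne hxw]

/-- the coloured vertices of colours `α`, `β` -/
def TwoCol (U : Finset V) (c : V → Fin 5) (α β : Fin 5) (x : V) : Prop :=
  x ∉ U ∧ (c x = α ∨ c x = β)

theorem extends_swap [DecidableEq V] {G : SimpleGraph V} {U : Finset V} {c : V → Fin 5} {w : V}
    (hc : PropOff G U c) (hw : w ∈ U) (α β : Fin 5) (hαβ : α ≠ β) (hα : α ≠ 4) (hβ : β ≠ 4)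
    (p q : V) (hpU : p ∉ U) (hp : c p = α)
    (hpu : ∀ x, G.Adj w x → x ∉ U → c x = α → x = p)
    (hqu : ∀ x, G.Adj w x → x ∉ U → c x = β → x = q)
    (hn : ¬ Relation.ReflTransGen (InAdj G (TwoCol U c α β)) p q) : Extends G U c w := by
  classical
  set R : V → Prop := fun x => Relation.ReflTransGen (InAdj G (TwoCol U c α β)) p x with hR
  have hRt : ∀ x, R x → TwoCol U c α β x := by
    intro x hx
    rcases Relation.ReflTransGen.cases_tail hx with h | ⟨y, _, h⟩
    · subst h; exact ⟨hpU, Or.inl hp⟩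
    · exact h.2.2
  set c1 : V → Fin 5 := fun x => if R x then Equiv.swap α β (c x) else c x with hc1
  have hc1R : ∀ x, R x → c1 x = Equiv.swap α β (c x) := fun x hx => if_pos hx
  have hc1n : ∀ x, ¬ R x → c1 x = c x := fun x hx => if_neg hx
  have hmix : ∀ x y, G.Adj x y → x ∉ U → y ∉ U → R x → ¬ R y → c1 x ≠ c1 y := by
    intro x y hxy hx hy hRx hRy
    have h1 := hRt x hRx
    have h2 : ¬ TwoCol U c α β y := fun h => hRy (hRx.tail ⟨hxy, h1, h⟩)
    rw [hc1R x hRx, hc1n y hRy]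
    have h3 : c y ≠ α ∧ c y ≠ β := by
      constructor
      · exact fun h => h2 ⟨hy, Or.inl h⟩
      · exact fun h => h2 ⟨hy, Or.inr h⟩
    rcases h1.2 with h | h
    · rw [h, Equiv.swap_apply_left]; exact h3.2.symm
    · rw [h, Equiv.swap_apply_right]; exact h3.1.symm
  have hprop : PropOff G U c1 := by
    intro x y hxy hx hy
    by_cases h1 : R x <;> by_cases h2 : R y
    · rw [hc1R x h1, hc1R y h2]
      exact fun h => hc x y hxy hx hy ((Equiv.swap α β).injective h)
    · exact hmix x y hxy hx hy h1 h2
    · exact (hmix y x hxy.symm hy hx h2 h1).symm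
    · rw [hc1n x h1, hc1n y h2]; exact hc x y hxy hx hy
  have h4 : ∀ x, c1 x = 4 ↔ c x = 4 := by
    intro x
    by_cases h1 : R x
    · rw [hc1R x h1]
      rcases (hRt x h1).2 with h | h
      · rw [h, Equiv.swap_apply_left]; simp [hα, hβ]
      · rw [h, Equiv.swap_apply_right]; simp [hα, hβ]
    · rw [hc1n x h1]
  obtain ⟨c', h5, h6, h7⟩ := extends_free hprop hw α hα (by
    intro x hwx hx h
    by_cases h1 : R x
    · rw [hc1R x h1] at h
      have h8 : c x = β := by
        have h9 := congrArg (Equiv.swap α β) h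
        rwa [Equiv.swap_apply_self, Equiv.swap_apply_left] at h9
      exact hn (hqu x hwx hx h8 ▸ h1)
    · rw [hc1n x h1] at h
      have := hpu x hwx hx h
      subst this
      exact h1 Relation.ReflTransGen.refl)
  exact ⟨c', h5, fun x hx => (h6 x hx).trans (h4 x), h7⟩

theorem kempe [Fintype V] [DecidableEq V] {G : SimpleGraph V} {σ : Equiv.Perm G.Dart}
    (hG : IsPlaneTriangulation G σ) {U : Finset V} {c : V → Fin 5} {w : V}
    (hc : PropOff G U c) (hw : w ∈ U) (N : Finset V) (hN : N.card ≤ 4)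
    (hNw : ∀ x, G.Adj w x → x ∉ U → c x ≠ 4 → x ∈ N) : Extends G U c w := by
  classical
  by_contra hcon
  have hex : ∀ k : Fin 5, k ≠ 4 → ∃ x, G.Adj w x ∧ x ∉ U ∧ c x = k := by
    intro k hk
    by_contra h
    push Not at h
    exact hcon (extends_free hc hw k hk h)
  have : Nonempty V := ⟨w⟩
  choose! p hp using hex
  have huniq : ∀ k : Fin 5, k ≠ 4 → ∀ x, G.Adj w x → x ∉ U → c x = k → x = p k := by
    intro k hk x hwx hx hcx
    have hsub : ((Finset.univ.erase (4 : Fin 5)).image p) ⊆ N := by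
      intro y hy
      obtain ⟨k', hk', rfl⟩ := Finset.mem_image.mp hy
      have hk' := (Finset.mem_erase.mp hk').1
      obtain ⟨a1, a2, a3⟩ := hp k' hk'
      exact hNw _ a1 a2 (by rw [a3]; exact hk')
    have hcard : ((Finset.univ.erase (4 : Fin 5)).image p).card = 4 := by
      rw [Finset.card_image_of_injOn]
      · rfl
      · intro i hi j hj hij
        have hi := (Finset.mem_erase.mp hi).1
        have hj := (Finset.mem_erase.mp hj).1
        rw [← (hp i hi).2.2, ← (hp j hj).2.2]
        exact congrArg c hij
    have heq := Finset.eq_of_subset_of_card_le hsub (by rw [hcard]; exact hN)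
    have hxN : x ∈ N := hNw x hwx hx (by rw [hcx]; exact hk)
    rw [← heq] at hxN
    obtain ⟨k', hk', rfl⟩ := Finset.mem_image.mp hxN
    have hk' := (Finset.mem_erase.mp hk').1
    have : k' = k := (hp k' hk').2.2.symm.trans hcx
    rw [this]
  have hconn : ∀ α β : Fin 5, α ≠ β → α ≠ 4 → β ≠ 4 →
      Relation.ReflTransGen (InAdj G (TwoCol U c α β)) (p α) (p β) := by
    intro α β hαβ hα hβ
    by_contra h
    exact hcon (extends_swap hc hw α β hαβ hα hβ (p α) (p β) (hp α hα).2.1 (hp α hα).2.2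
      (huniq α hα) (huniq β hβ) h)
  let d : G.Dart := ⟨(w, p 0), (hp 0 (by decide)).1⟩
  have hidx : ∀ k : Fin 5, k ≠ 4 → ∃ n : ℕ, ((σ ^ n) d).snd = p k ∧
      ∀ m < n, ((σ ^ m) d) ≠ (σ ^ n) d := by
    intro k hk
    have hex2 := exists_pow hG.rot d ⟨(w, p k), (hp k hk).1⟩ rfl
    refine ⟨Nat.find hex2, ?_, ?_⟩
    · rw [Nat.find_spec hex2]
    · intro m hm
      rw [Nat.find_spec hex2]
      exact Nat.find_min hex2 hm
  choose! n hn hmin using hidx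
  have hpinj : ∀ i j : Fin 5, i ≠ 4 → j ≠ 4 → i ≠ j → n i ≠ n j := by
    intro i j hi hj hij h
    have h1 := hn i hi
    rw [h, hn j hj] at h1
    apply hij
    rw [← (hp i hi).2.2, ← (hp j hj).2.2, h1]
  have hpos : ∀ i : Fin 5, i ≠ 4 → i ≠ 0 → 0 < n i := by
    intro i hi hi0
    rcases Nat.eq_zero_or_pos (n i) with h | h
    · exfalso
      have h1 := hn i hi
      rw [h] at h1
      have h2 : p 0 = p i := h1
      apply hi0
      rw [← (hp i hi).2.2, ← (hp 0 (by decide)).2.2, h2]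
    · exact h
  have key : ∀ i j k : Fin 5, i ≠ 4 → j ≠ 4 → k ≠ 4 → i ≠ 0 → j ≠ 0 → k ≠ 0 → i ≠ j → j ≠ k →
      i ≠ k → ¬ (n i < n j ∧ n j < n k) := by
    rintro i j k hi hj hk hi0 hj0 hk0 hij hjk hik ⟨h1, h2⟩
    refine crossing hG (TwoCol U c 0 j) (TwoCol U c i k) ?_ w (fun h => h.1 hw) (fun h => h.1 hw)
      d rfl (n i) (n j) (n k) (hpos i hi hi0) h1 h2 (hmin k hk) ?_ ?_ ?_ ?_ ?_ ?_
    · rintro x ⟨_, hx⟩ ⟨_, hx'⟩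
      rcases hx with h | h <;> rcases hx' with h' | h' <;> rw [h] at h' <;> tauto
    · exact ⟨(hp 0 (by decide)).2.1, Or.inl (hp 0 (by decide)).2.2⟩
    · rw [hn i hi]; exact ⟨(hp i hi).2.1, Or.inl (hp i hi).2.2⟩
    · rw [hn j hj]; exact ⟨(hp j hj).2.1, Or.inr (hp j hj).2.2⟩
    · rw [hn k hk]; exact ⟨(hp k hk).2.1, Or.inr (hp k hk).2.2⟩
    · rw [hn j hj]; exact hconn 0 j hj0.symm (by decide) hj
    · rw [hn i hi, hn k hk]; exact hconn i k hik hi hk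
  have a12 := hpinj 1 2 (by decide) (by decide) (by decide)
  have a13 := hpinj 1 3 (by decide) (by decide) (by decide)
  have a23 := hpinj 2 3 (by decide) (by decide) (by decide)
  have b1 := key 1 2 3 (by decide) (by decide) (by decide) (by decide) (by decide) (by decide)
    (by decide) (by decide) (by decide)
  have b2 := key 1 3 2 (by decide) (by decide) (by decide) (by decide) (by decide) (by decide)
    (by decide) (by decide) (by decide)
  have b3 := key 2 1 3 (by decide) (by decide) (by decide) (by decide) (by decide) (by decide)
    (by decide) (by decide) (by decide)
  have b4 := key 2 3 1 (by decide) (by decide) (by decide) (by decide) (by decide) (by decide)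
    (by decide) (by decide) (by decide)
  have b5 := key 3 1 2 (by decide) (by decide) (by decide) (by decide) (by decide) (by decide)
    (by decide) (by decide) (by decide)
  have b6 := key 3 2 1 (by decide) (by decide) (by decide) (by decide) (by decide) (by decide)
    (by decide) (by decide) (by decide)
  omega

/-- state: proper off `U`, with at most `M` coloured vertices in the last class -/
def St [Fintype V] [DecidableEq V] (G : SimpleGraph V) (U : Finset V) (c : V → Fin 5) (M : ℕ) :
    Prop :=
  PropOff G U c ∧ (Finset.univ.filter fun x => x ∉ U ∧ c x = 4).card ≤ M

open Classical in
/-- neighbours as a finset -/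
noncomputable def nbrs [Fintype V] (G : SimpleGraph V) (v : V) : Finset V :=
  Finset.univ.filter fun x => G.Adj v x

theorem mem_nbrs [Fintype V] {G : SimpleGraph V} {v x : V} : x ∈ nbrs G v ↔ G.Adj v x := by
  simp [nbrs]

theorem card_nbrs [Fintype V] (G : SimpleGraph V) (v : V) : (nbrs G v).card = deg G v := by
  classical
  unfold deg nbrs
  rw [Nat.card_eq_fintype_card, Fintype.card_subtype]
  congr 1

theorem st_kempe [Fintype V] [DecidableEq V] {G : SimpleGraph V} {σ : Equiv.Perm G.Dart}
    (hG : IsPlaneTriangulation G σ) {U : Finset V} {c : V → Fin 5} {w : V} {M : ℕ}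
    (hc : St G U c M) (hw : w ∈ U) (X : Finset V) (hX : X ⊆ nbrs G w)
    (hcard : deg G w ≤ X.card + 4) (hXc : ∀ x ∈ X, x ∈ U ∨ c x = 4) :
    ∃ c', St G (U.erase w) c' M ∧ (∀ x ∉ U, (c' x = 4 ↔ c x = 4)) := by
  obtain ⟨c', h1, h2, h3⟩ := kempe hG hc.1 hw (nbrs G w \ X) (by
    rw [Finset.card_sdiff_of_subset hX, card_nbrs]; omega) (by
    intro x hwx hx hx4
    rw [Finset.mem_sdiff, mem_nbrs]
    refine ⟨hwx, fun h => ?_⟩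
    rcases hXc x h with h | h
    · exact hx h
    · exact hx4 h)
  refine ⟨c', ⟨h1, le_trans (Finset.card_le_card ?_) hc.2⟩, h2⟩
  intro x
  simp only [Finset.mem_filter, Finset.mem_univ, true_and, Finset.mem_erase]
  rintro ⟨hx, hx4⟩
  have hxw : x ≠ w := by rintro rfl; exact h3 hx4
  have hxU : x ∉ U := fun h => hx ⟨hxw, h⟩
  exact ⟨hxU, (h2 x hxU).mp hx4⟩

theorem st_five [Fintype V] [DecidableEq V] {G : SimpleGraph V}
    {U : Finset V} {c : V → Fin 5} {w : V} {M : ℕ}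
    (hc : St G U c M) (hw : w ∈ U) (h : ∀ x, G.Adj w x → x ∉ U → c x ≠ 4) :
    St G (U.erase w) (Function.update c w 4) (M + 1) := by
  refine ⟨extend_free hc.1 hw 4 h, ?_⟩
  refine le_trans (Finset.card_le_card (t := insert w
    (Finset.univ.filter fun x => x ∉ U ∧ c x = 4)) ?_)
    ((Finset.card_insert_le _ _).trans (Nat.succ_le_succ hc.2))
  intro x
  simp only [Finset.mem_filter, Finset.mem_univ, true_and, Finset.mem_erase, Finset.mem_insert]
  rintro ⟨hx, hx4⟩
  by_cases hxw : x = w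
  · exact Or.inl hxw
  · rw [Function.update_of_ne hxw] at hx4
    exact Or.inr ⟨fun h => hx ⟨hxw, h⟩, hx4⟩

theorem st_iter [Fintype V] [DecidableEq V] {G : SimpleGraph V} {σ : Equiv.Perm G.Dart}
    (hG : IsPlaneTriangulation G σ) {M : ℕ} (T : Finset V) :
    ∀ (U : Finset V) (c : V → Fin 5), St G U c M → T ⊆ U → (∀ t ∈ T, deg G t = 5) →
    (∀ t ∈ T, ∃ s, G.Adj t s ∧ ((s ∉ U ∧ c s = 4) ∨ (s ∈ U ∧ s ∉ T))) →
    ∃ c', St G (U \ T) c' M ∧ ∀ x ∉ U, (c' x = 4 ↔ c x = 4) := by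
  induction T using Finset.induction_on with
  | empty => intro U c hc _ _ _; exact ⟨c, by simpa using hc, fun _ _ => Iff.rfl⟩
  | @insert t T ht ih =>
    intro U c hc hTU hdeg hs
    have htU : t ∈ U := hTU (Finset.mem_insert_self _ _)
    obtain ⟨s, hts, hs'⟩ := hs t (Finset.mem_insert_self _ _)
    obtain ⟨c1, h1, h2⟩ := st_kempe hG hc htU {s}
      (by rw [Finset.singleton_subset_iff, mem_nbrs]; exact hts)
      (by rw [hdeg t (Finset.mem_insert_self _ _), Finset.card_singleton])
      (by
        intro x hx
        rw [Finset.mem_singleton] at hx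
        subst hx
        rcases hs' with h | h
        · exact Or.inr h.2
        · exact Or.inl h.1)
    obtain ⟨c2, h3, h4⟩ := ih (U.erase t) c1 h1
      (fun x hx => Finset.mem_erase.mpr
        ⟨fun h => ht (h ▸ hx), hTU (Finset.mem_insert_of_mem hx)⟩)
      (fun x hx => hdeg x (Finset.mem_insert_of_mem hx)) (by
        intro x hx
        obtain ⟨s, hxs, hs'⟩ := hs x (Finset.mem_insert_of_mem hx)
        refine ⟨s, hxs, ?_⟩
        rcases hs' with h | h
        · exact Or.inl ⟨fun h' => h.1 (Finset.mem_of_mem_erase h'), (h2 s h.1).mpr h.2⟩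
        · refine Or.inr ⟨Finset.mem_erase.mpr ⟨?_, h.1⟩, ?_⟩
          · exact fun h' => h.2 (h' ▸ Finset.mem_insert_self _ _)
          · exact fun h' => h.2 (Finset.mem_insert_of_mem h'))
    refine ⟨c2, ?_, ?_⟩
    · have : U \ insert t T = U.erase t \ T := by
        ext x
        simp only [Finset.mem_sdiff, Finset.mem_insert, Finset.mem_erase]
        tauto
      rw [this]; exact h3
    · intro x hx
      exact (h4 x (fun h' => hx (Finset.mem_of_mem_erase h'))).trans (h2 x hx)

end Kempe

section Local

theorem perm_apply_inv {α : Type*} (f : Equiv.Perm α) (x : α) : f (f⁻¹ x) = x :=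
  Equiv.apply_symm_apply f x

theorem face_cube [Fintype V] {G : SimpleGraph V} {σ : Equiv.Perm G.Dart}
    (hG : IsPlaneTriangulation G σ) (d : G.Dart) :
    facePerm σ (facePerm σ (facePerm σ d)) = d := by
  classical
  have hf : ∀ e : G.Dart, (facePerm σ e).fst = e.snd := fun e => hG.rot.fst_eq e.symm
  have hne : facePerm σ d ≠ d := by
    intro h
    have h1 := hf d
    rw [h] at h1
    exact d.adj.ne h1
  have hcyc := Equiv.Perm.isCycle_cycleOf (facePerm σ) hne
  have h3 := hG.face_size_eq d
  unfold faceSize at h3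
  have hcard : ((facePerm σ).cycleOf d).support.card = 3 := by
    rw [← h3, Nat.card_eq_fintype_card, Fintype.card_subtype]
    congr 1
    ext e
    rw [Equiv.Perm.mem_support_cycleOf_iff' hne]
    simp
  have h4 : ((facePerm σ).cycleOf d) ^ 3 = 1 := by
    rw [← hcard, ← hcyc.orderOf]; exact pow_orderOf_eq_one _
  have h5 := Equiv.Perm.cycleOf_pow_apply_self (facePerm σ) d 3
  rw [h4] at h5
  exact h5.symm

theorem next_adj [Fintype V] {G : SimpleGraph V} {σ : Equiv.Perm G.Dart}
    (hG : IsPlaneTriangulation G σ) (d : G.Dart) : G.Adj d.snd (σ d).snd := by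
  have hf : ∀ e : G.Dart, (facePerm σ e).fst = e.snd := fun e => hG.rot.fst_eq e.symm
  have h0 : facePerm σ d.symm = σ d := by
    show σ d.symm.symm = σ d
    rw [SimpleGraph.Dart.symm_symm]
  have h1 := face_cube hG d.symm
  rw [h0] at h1
  have h2 := hf (facePerm σ (σ d))
  rw [h1] at h2
  have h3 := hf (σ d)
  have h4 := (facePerm σ (σ d)).adj
  rw [h3, ← h2] at h4
  exact h4.symm

theorem two_common [Fintype V] {G : SimpleGraph V} {σ : Equiv.Perm G.Dart}
    (hG : IsPlaneTriangulation G σ) (v a : V) (hva : G.Adj v a) (hdeg : deg G v = 7) :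
    ∃ x y, x ≠ y ∧ G.Adj v x ∧ G.Adj v y ∧ G.Adj x a ∧ G.Adj y a := by
  classical
  let d : G.Dart := ⟨(v, a), hva⟩
  have hs1 : (σ d).fst = v := hG.rot.fst_eq d
  have hs2 : (σ⁻¹ d).fst = v := by
    have := hG.rot.fst_eq (σ⁻¹ d)
    rw [perm_apply_inv] at this
    exact this.symm
  refine ⟨(σ d).snd, (σ⁻¹ d).snd, ?_, ?_, ?_, (next_adj hG d).symm, ?_⟩
  · intro h
    have heq : σ d = σ⁻¹ d := by
      apply SimpleGraph.Dart.ext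
      exact Prod.ext (hs1.trans hs2.symm) h
    have h2 : σ (σ d) = d := by rw [heq, perm_apply_inv]
    have h3 : ∀ n : ℕ, (σ ^ n) d = d ∨ (σ ^ n) d = σ d := by
      intro n
      induction n with
      | zero => exact Or.inl rfl
      | succ n ih =>
        rw [pow_succ', Equiv.Perm.mul_apply]
        rcases ih with h | h
        · rw [h]; exact Or.inr rfl
        · rw [h]; exact Or.inl h2
    have h4 : nbrs G v ⊆ {a, (σ d).snd} := by
      intro x hx
      rw [mem_nbrs] at hx
      obtain ⟨n, hn⟩ := exists_pow hG.rot d ⟨(v, x), hx⟩ rfl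
      rcases h3 n with h | h
      · have : x = a := by
          have := hn.symm.trans h
          exact congrArg (fun e : G.Dart => e.snd) this
        simp [this]
      · have : x = (σ d).snd := by
          have := hn.symm.trans h
          exact congrArg (fun e : G.Dart => e.snd) this
        simp [this]
    have h5 := Finset.card_le_card h4
    rw [card_nbrs, hdeg] at h5
    have := h5.trans Finset.card_le_two
    omega
  · have := (σ d).adj
    rwa [hs1] at this
  · have := (σ⁻¹ d).adj
    rwa [hs2] at this
  · have := next_adj hG (σ⁻¹ d)
    rw [perm_apply_inv] at this
    exact this

end Local

theorem statement10 [Fintype V] (G : SimpleGraph V) (σ : Equiv.Perm G.Dart)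
    (hG : IsMinimalCounterexample G σ) :
    ∀ v : V, deg G v = 7 → Nat.card {u : V | G.Adj v u ∧ deg G u = 5} ≤ 4 := by
  classical
  intro v hv
  by_contra hcon
  push Not at hcon
  obtain ⟨hT, hno, hmin⟩ := hG
  have hF : 5 ≤ ((nbrs G v).filter fun u => deg G u = 5).card := by
    have : Nat.card {u : V | G.Adj v u ∧ deg G u = 5} =
        ((nbrs G v).filter fun u => deg G u = 5).card := by
      rw [Nat.card_eq_fintype_card, Fintype.card_ofFinset]
      congr 1
      ext x
      simp [mem_nbrs]
    omega
  obtain ⟨D, hDF, hD5⟩ := Finset.exists_subset_card_eq hF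
  have hDadj : ∀ u ∈ D, G.Adj v u := fun u hu =>
    mem_nbrs.mp (Finset.mem_filter.mp (hDF hu)).1
  have hDdeg : ∀ u ∈ D, deg G u = 5 := fun u hu => (Finset.mem_filter.mp (hDF hu)).2
  have hDn : D ⊆ nbrs G v := fun u hu => mem_nbrs.mpr (hDadj u hu)
  have hvD : v ∉ D := fun h => (hDadj v h).ne rfl
  set S : Finset V := insert v D with hS
  have hvS : v ∈ S := Finset.mem_insert_self _ _
  have hDS : D ⊆ S := Finset.subset_insert _ _
  have hScard : S.card = 6 := by rw [hS, Finset.card_insert_of_notMem hvD, hD5]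
  have hSle : S.card ≤ Fintype.card V := Finset.card_le_univ S
  have hcardW : Fintype.card {x : V // x ∉ S} = Fintype.card V - 6 := by
    rw [Fintype.card_subtype_compl, Fintype.card_coe, hScard]
  -- colour the rest
  obtain ⟨c0, hc0, k, hk⟩ := hmin {x : V // x ∉ S} (G.comap Subtype.val)
    ⟨V, inferInstance, G, σ, hT, ⟨Subtype.val, fun h => h⟩, Subtype.val_injective⟩
    (by rw [hcardW]; omega)
  rw [hcardW] at hk
  set M := Nat.card {w : {x : V // x ∉ S} | c0 w = k} with hM
  -- it suffices to reach a full colouring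
  have hdone : ∀ c, ¬ St G ∅ c (M + 1) := by
    rintro c ⟨hc1, hc2⟩
    refine hno ⟨c, fun x y h => hc1 x y h (Finset.notMem_empty _) (Finset.notMem_empty _), 4, ?_⟩
    have : Nat.card {x : V | c x = 4} = (Finset.univ.filter fun x => x ∉ (∅ : Finset V) ∧ c x = 4).card := by
      rw [Nat.card_eq_fintype_card, Fintype.card_ofFinset]
      congr 1
      ext x
      simp
    omega
  have hmono : ∀ U c, St G U c M → St G U c (M + 1) := fun U c h => ⟨h.1, h.2.trans (Nat.le_succ _)⟩
  obtain ⟨c, hc⟩ : ∃ c, St G S c M := by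
    refine ⟨fun x => if h : x ∉ S then Equiv.swap k 4 (c0 ⟨x, h⟩) else 0, ?_, ?_⟩
    · intro x y hxy hx hy
      simp only [dif_pos hx, dif_pos hy]
      intro h
      exact hc0 (u := ⟨x, hx⟩) (w := ⟨y, hy⟩) hxy ((Equiv.swap k 4).injective h)
    · rw [hM, Nat.card_eq_fintype_card, ← Set.toFinset_card]
      refine Finset.card_le_card_of_surjOn Subtype.val ?_
      intro x hx
      simp only [Finset.coe_filter, Finset.mem_univ, true_and, Set.mem_setOf_eq] at hx
      obtain ⟨hx, hx4⟩ := hx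
      rw [dif_pos hx] at hx4
      refine ⟨⟨x, hx⟩, ?_, rfl⟩
      have h9 := congrArg (Equiv.swap k 4) hx4
      rw [Equiv.swap_apply_self, Equiv.swap_apply_right] at h9
      simpa using h9
  by_cases hA : ∃ a, G.Adj v a ∧ a ∉ S ∧ c a = 4
  · obtain ⟨a, hva, haS, ha4⟩ := hA
    have haD : a ∉ D := fun h => haS (hDS h)
    by_cases hB : ∃ u ∈ D, ∀ x, G.Adj u x → x ∉ S → c x ≠ 4
    · obtain ⟨u, huD, hu⟩ := hB
      obtain ⟨t, htD, hta⟩ : ∃ t ∈ D, G.Adj t a := by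
        obtain ⟨x, y, hxy, hvx, hvy, hxa, hya⟩ := two_common hT v a hva hv
        by_contra hno2
        push Not at hno2
        have hx : x ∉ D := fun h => hno2 x h hxa
        have hy : y ∉ D := fun h => hno2 y h hya
        have hsub : ({a, x, y} : Finset V) ⊆ nbrs G v \ D := by
          intro z hz
          simp only [Finset.mem_insert, Finset.mem_singleton] at hz
          rw [Finset.mem_sdiff, mem_nbrs]
          rcases hz with rfl | rfl | rfl
          · exact ⟨hva, haD⟩
          · exact ⟨hvx, hx⟩
          · exact ⟨hvy, hy⟩
        have h1 := Finset.card_le_card hsub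
        rw [Finset.card_sdiff_of_subset hDn, card_nbrs, hv, hD5,
          Finset.card_eq_three.mpr ⟨a, x, y, hxa.ne.symm, hya.ne.symm, hxy, rfl⟩] at h1
        omega
      have htu : t ≠ u := by
        rintro rfl
        exact hu a hta haS ha4
      have huv : u ≠ v := fun h => hvD (h ▸ huD)
      have htv : t ≠ v := fun h => hvD (h ▸ htD)
      have hau : a ≠ u := fun h => haD (h ▸ huD)
      have hat : a ≠ t := hta.ne.symm
      have hst1 := st_five hc (hDS huD) hu
      obtain ⟨c2, hst2, hp2⟩ := st_iter hT ((D.erase u).erase t) _ _ hst1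
        (by
          intro x hx
          rw [Finset.mem_erase, Finset.mem_erase] at hx
          exact Finset.mem_erase.mpr ⟨hx.2.1, hDS hx.2.2⟩)
        (by
          intro x hx
          rw [Finset.mem_erase, Finset.mem_erase] at hx
          exact hDdeg x hx.2.2)
        (by
          intro x hx
          rw [Finset.mem_erase, Finset.mem_erase] at hx
          refine ⟨v, (hDadj x hx.2.2).symm, Or.inr ⟨Finset.mem_erase.mpr ⟨huv.symm, hvS⟩, ?_⟩⟩
          intro h
          rw [Finset.mem_erase, Finset.mem_erase] at h
          exact hvD h.2.2)
      have hU2 : S.erase u \ ((D.erase u).erase t) = {v, t} := by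
        ext x
        simp only [hS, Finset.mem_sdiff, Finset.mem_erase, Finset.mem_insert, Finset.mem_singleton]
        constructor
        · rintro ⟨⟨h1, h2⟩, h3⟩
          tauto
        · rintro (rfl | rfl)
          · exact ⟨⟨huv.symm, Or.inl rfl⟩, fun h => hvD h.2.2⟩
          · exact ⟨⟨htu, Or.inr htD⟩, fun h => h.1 rfl⟩
      rw [hU2] at hst2
      have ha2 : c2 a = 4 := by
        refine (hp2 a (fun h => haS (Finset.mem_of_mem_erase h))).mpr ?_
        rw [Function.update_of_ne hau]; exact ha4
      have hu2 : c2 u = 4 := by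
        refine (hp2 u (Finset.notMem_erase _ _)).mpr ?_
        rw [Function.update_self]
      obtain ⟨c3, hst3, hp3⟩ := st_kempe hT hst2 (w := v) (by simp) {a, u, t}
        (by
          intro z hz
          simp only [Finset.mem_insert, Finset.mem_singleton] at hz
          rw [mem_nbrs]
          rcases hz with rfl | rfl | rfl
          · exact hva
          · exact hDadj _ huD
          · exact hDadj _ htD)
        (by rw [hv, Finset.card_eq_three.mpr ⟨a, u, t, hau, hat, htu.symm, rfl⟩])
        (by
          intro z hz
          simp only [Finset.mem_insert, Finset.mem_singleton] at hz
          rcases hz with rfl | rfl | rfl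
          · exact Or.inr ha2
          · exact Or.inr hu2
          · exact Or.inl (by simp))
      have hU3 : ({v, t} : Finset V).erase v = {t} := by
        ext x
        simp only [Finset.mem_erase, Finset.mem_insert, Finset.mem_singleton]
        constructor
        · tauto
        · rintro rfl; exact ⟨htv, Or.inr rfl⟩
      rw [hU3] at hst3
      have ha3 : c3 a = 4 := by
        refine (hp3 a ?_).mpr ha2
        simp only [Finset.mem_insert, Finset.mem_singleton, not_or]
        exact ⟨hva.ne.symm, hat⟩
      obtain ⟨c4, hst4, -⟩ := st_kempe hT hst3 (w := t) (by simp) {a}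
        (by rw [Finset.singleton_subset_iff, mem_nbrs]; exact hta)
        (by rw [hDdeg t htD, Finset.card_singleton])
        (by
          intro z hz
          rw [Finset.mem_singleton] at hz
          subst hz
          exact Or.inr ha3)
      rw [Finset.erase_singleton] at hst4
      exact hdone c4 hst4
    · push Not at hB
      obtain ⟨c1, hst1, hp1⟩ := st_kempe hT hc hvS (insert a D)
        (by
          intro z hz
          rw [Finset.mem_insert] at hz
          rcases hz with rfl | h
          · exact mem_nbrs.mpr hva
          · exact hDn h)
        (by rw [hv, Finset.card_insert_of_notMem haD, hD5]; omega)
        (by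
          intro z hz
          rw [Finset.mem_insert] at hz
          rcases hz with rfl | h
          · exact Or.inr ha4
          · exact Or.inl (hDS h))
      have hU1 : S.erase v = D := Finset.erase_insert hvD
      rw [hU1] at hst1
      obtain ⟨c2, hst2, -⟩ := st_iter hT D _ _ hst1 (Finset.Subset.refl _) hDdeg (by
        intro t ht
        obtain ⟨s, hts, hsS, hs4⟩ := hB t ht
        exact ⟨s, hts, Or.inl ⟨fun h => hsS (hDS h), (hp1 s hsS).mpr hs4⟩⟩)
      rw [Finset.sdiff_self] at hst2
      exact hdone c2 (hmono _ _ hst2)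
  · push Not at hA
    have hst1 := st_five hc hvS hA
    have hU1 : S.erase v = D := Finset.erase_insert hvD
    rw [hU1] at hst1
    obtain ⟨c2, hst2, -⟩ := st_iter hT D _ _ hst1 (Finset.Subset.refl _) hDdeg (by
      intro t ht
      exact ⟨v, (hDadj t ht).symm, Or.inl ⟨hvD, Function.update_self _ _ _⟩⟩)
    rw [Finset.sdiff_self] at hst2
    exact hdone c2 hst2
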